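/- Let n ≥ 1, d ≥ 3 and 1 ≤ N ≤ n^d be integers. Let T₁ = Σ_{i₁,…,i_d=1}^{n} e_{i₁} ⊗ ⋯ ⊗ e_{i_d} ⊗ e_{(i₁,…,i_d)} ∈ (ℂ^n)^{⊗d} ⊗ ℂ^{n^d} and let T₂ = Σ_{j=1}^{N} e_j ⊗ e_j ⊗ e₀ ⊗ ⋯ ⊗ e₀ ∈ ℂ^N ⊗ ℂ^N ⊗ ℂ¹ ⊗ ⋯ ⊗ ℂ¹ (both tensors of order d+1). Then R̲(T₁) = n^d, R̲(T₂) = N, and R̲(T₁ ⊕ T₂) ≤ n^d + 2n^{d−1} + n²(n+1)^{d−3} + 1. -/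

import Mathlib

open Finset

namespace Subadditivity

noncomputable section

/-- A tensor of order `k` over `ℂ` with `i`-th factor the space `ℂ^{ι i}` of complex-valued
functions on the finite index type `ι i`; the tensor is represented by the array of its
coordinates with respect to the standard basis, i.e. by an element of
`ℂ^{ι 0} ⊗ ⋯ ⊗ ℂ^{ι (k-1)} ≃ ((∀ i, ι i) → ℂ)`. -/
abbrev Tensor {k : ℕ} (ι : Fin k → Type) : Type := (∀ i, ι i) → ℂ

/-- `T` is a sum of `r` simple (rank-one) tensors `v j 0 ⊗ ⋯ ⊗ v j (k-1)`. -/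
def HasRankLE {k : ℕ} {ι : Fin k → Type} (T : Tensor ι) (r : ℕ) : Prop :=
  ∃ v : Fin r → (∀ i, ι i → ℂ), T = fun x => ∑ j : Fin r, ∏ i : Fin k, v j i (x i)

/-- Tensor rank: the least `r` such that `T` is a sum of `r` simple tensors. -/
noncomputable def rank {k : ℕ} {ι : Fin k → Type} (T : Tensor ι) : ℕ :=
  sInf {r | HasRankLE T r}

/-- Border rank is at most `r`: `T` lies in the closure of the set of tensors of rank `≤ r`. -/
def HasBorderRankLE {k : ℕ} {ι : Fin k → Type} (T : Tensor ι) (r : ℕ) : Prop :=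
  T ∈ closure {S : Tensor ι | HasRankLE S r}

/-- Border rank. -/
noncomputable def borderRank {k : ℕ} {ι : Fin k → Type} (T : Tensor ι) : ℕ :=
  sInf {r | HasBorderRankLE T r}

open scoped Classical in
/-- Direct sum of two tensors of order `k`: the coordinates supported on the `ι`-part are
those of `T`, the coordinates supported on the `κ`-part are those of `S`, and all mixed
coordinates vanish. -/
noncomputable def dsum {k : ℕ} {ι κ : Fin k → Type} (T : Tensor ι) (S : Tensor κ) :
    Tensor (fun i => ι i ⊕ κ i) := fun x =>
  (if h : ∃ y : ∀ i, ι i, x = fun i => Sum.inl (y i) then T h.choose else 0) +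
  (if h : ∃ z : ∀ i, κ i, x = fun i => Sum.inr (z i) then S h.choose else 0)

/-- Kronecker product of two tensors of order `k`. -/
def kron {k : ℕ} {ι κ : Fin k → Type} (T : Tensor ι) (S : Tensor κ) :
    Tensor (fun i => ι i × κ i) := fun x =>
  T (fun i => (x i).1) * S (fun i => (x i).2)

/-- `N`-th Kronecker power of a tensor of order `k`. -/
def kpow {k : ℕ} {ι : Fin k → Type} (T : Tensor ι) (N : ℕ) :
    Tensor (fun i => Fin N → ι i) := fun x => ∏ j : Fin N, T (fun i => x i j)

/-- The unit tensor `u_k(r) = Σ_{j=1}^r e_j ⊗ ⋯ ⊗ e_j` of order `k`. -/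
def unit (k r : ℕ) : Tensor (fun _ : Fin k => Fin r) := fun x =>
  ∑ j : Fin r, ∏ i : Fin k, (if x i = j then (1 : ℂ) else 0)

/-- `S` is a degeneration of `T`: `S` lies in the closure of the set of tensors obtained
from `T` by applying linear maps `A i` on each factor. -/
def Degen {k : ℕ} {ι κ : Fin k → Type} [∀ i, Fintype (κ i)]
    (S : Tensor ι) (T : Tensor κ) : Prop :=
  S ∈ closure {S' : Tensor ι | ∃ A : ∀ i, ι i → κ i → ℂ,
    S' = fun x => ∑ y : ∀ i, κ i, (∏ i : Fin k, A i (x i) (y i)) * T y}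

/-- Kronecker delta. -/
def delta {α : Type} [DecidableEq α] (a b : α) : ℂ := if a = b then 1 else 0

/-- Factor index types of the order-`(d+1)` spider tensor: positions `0, …, d-1`
carry `ℂ^n`, and position `d` carries `ℂ^{n^d}`, indexed by `d`-tuples. -/
def famV (n d : ℕ) : Fin (d + 1) → Type :=
  fun i => if (i : ℕ) < d then Fin n else (Fin d → Fin n)

def vlow {n d : ℕ} {i : Fin (d + 1)} (h : (i : ℕ) < d) (u : famV n d i) : Fin n :=
  cast (by simp [famV, h]) u

def vhigh {n d : ℕ} {i : Fin (d + 1)} (h : ¬ (i : ℕ) < d) (u : famV n d i) :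
    Fin d → Fin n :=
  cast (by simp [famV, h]) u

/-- The order-`(d+1)` spider tensor
`T₁ = Σ_{i₁,…,i_d} e_{i₁} ⊗ ⋯ ⊗ e_{i_d} ⊗ e_{(i₁,…,i_d)} ∈ (ℂ^n)^{⊗d} ⊗ ℂ^{n^d}`. -/
def bigSpider (n d : ℕ) : Tensor (famV n d) := fun x =>
  ∏ j : Fin d, delta (α := Fin n)
    (vlow (i := Fin.castSucc j) (by simp) (x (Fin.castSucc j)))
    (vhigh (i := Fin.last d) (by simp) (x (Fin.last d)) j)

/-- Factor index types of the order-`(d+1)` tensor `T₂`: positions `0, 1` carry `ℂ^N`,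
all other positions carry `ℂ¹`. -/
def famW (N d : ℕ) : Fin (d + 1) → Type :=
  fun i => if (i : ℕ) < 2 then Fin N else Fin 1

def wlow {N d : ℕ} {i : Fin (d + 1)} (h : (i : ℕ) < 2) (u : famW N d i) : Fin N :=
  cast (by simp [famW, h]) u

/-- The order-`(d+1)` tensor `T₂ = Σ_{j=1}^N e_j ⊗ e_j ⊗ e₀ ⊗ ⋯ ⊗ e₀ ∈ ℂ^N ⊗ ℂ^N ⊗ ℂ¹ ⊗ ⋯ ⊗ ℂ¹`. -/
def bigMat (N d : ℕ) (hd : 1 ≤ d) : Tensor (famW N d) := fun x =>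
  delta (α := Fin N)
    (wlow (i := (⟨0, Nat.succ_pos d⟩ : Fin (d + 1))) (by simp) (x ⟨0, Nat.succ_pos d⟩))
    (wlow (i := (⟨1, by omega⟩ : Fin (d + 1))) (by simp) (x ⟨1, by omega⟩))

/-- Equality of the tensor with a sum of simple tensors over any finite index type bounds its rank. -/
lemma hasRankLE_of_sum {k : ℕ} {ι : Fin k → Type} {T : Tensor ι} {κ : Type} [Fintype κ]
    (v : κ → (∀ i, ι i → ℂ)) (h : ∀ x, T x = ∑ j, ∏ i, v j i (x i)) :
    HasRankLE T (Fintype.card κ) := by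
  refine ⟨fun j => v ((Fintype.equivFin κ).symm j), ?_⟩
  funext x
  rw [h, ← Equiv.sum_comp (Fintype.equivFin κ).symm]

lemma HasRankLE.hasBorderRankLE {k : ℕ} {ι : Fin k → Type} {T : Tensor ι} {r : ℕ}
    (h : HasRankLE T r) : HasBorderRankLE T r := subset_closure h

lemma dsum_inl {k : ℕ} {ι κ : Fin (k + 1) → Type} (T : Tensor ι) (S : Tensor κ)
    (y : ∀ i, ι i) : dsum T S (fun i => Sum.inl (y i)) = T y := by
  have h1 : ∃ y' : ∀ i, ι i,
      (fun i => (Sum.inl (y i) : ι i ⊕ κ i)) = fun i => Sum.inl (y' i) := ⟨y, rfl⟩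
  have h2 : ¬ ∃ z : ∀ i, κ i,
      (fun i => (Sum.inl (y i) : ι i ⊕ κ i)) = fun i => Sum.inr (z i) := by
    rintro ⟨z, hz⟩
    simpa using congrFun hz 0
  have h3 : h1.choose = y := by
    funext i
    exact (Sum.inl_injective (congrFun h1.choose_spec i)).symm
  rw [dsum, dif_pos h1, dif_neg h2, h3, add_zero]

lemma dsum_inr {k : ℕ} {ι κ : Fin (k + 1) → Type} (T : Tensor ι) (S : Tensor κ)
    (z : ∀ i, κ i) : dsum T S (fun i => Sum.inr (z i)) = S z := by
  have h1 : ∃ z' : ∀ i, κ i,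
      (fun i => (Sum.inr (z i) : ι i ⊕ κ i)) = fun i => Sum.inr (z' i) := ⟨z, rfl⟩
  have h2 : ¬ ∃ y : ∀ i, ι i,
      (fun i => (Sum.inr (z i) : ι i ⊕ κ i)) = fun i => Sum.inl (y i) := by
    rintro ⟨y, hy⟩
    simpa using congrFun hy 0
  have h3 : h1.choose = z := by
    funext i
    exact (Sum.inr_injective (congrFun h1.choose_spec i)).symm
  rw [dsum, dif_neg h2, dif_pos h1, h3, zero_add]

lemma dsum_mixed {k : ℕ} {ι κ : Fin k → Type} (T : Tensor ι) (S : Tensor κ)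
    {x : ∀ i, ι i ⊕ κ i} {i j : Fin k} {u : ι i} {w : κ j}
    (hi : x i = Sum.inl u) (hj : x j = Sum.inr w) : dsum T S x = 0 := by
  rw [dsum, dif_neg, dif_neg, add_zero]
  · rintro ⟨z, rfl⟩
    simp at hi
  · rintro ⟨y, rfl⟩
    simp at hj

lemma eq_inl_or_eq_inr_or_mixed {k : ℕ} {ι κ : Fin k → Type} (x : ∀ i, ι i ⊕ κ i) :
    (∃ y : ∀ i, ι i, x = fun i => Sum.inl (y i)) ∨
    (∃ z : ∀ i, κ i, x = fun i => Sum.inr (z i)) ∨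
    ∃ i j, ∃ (u : ι i) (w : κ j), x i = Sum.inl u ∧ x j = Sum.inr w := by
  by_cases h1 : ∀ i, ∃ u, x i = Sum.inl u
  · choose y hy using h1
    exact Or.inl ⟨y, funext hy⟩
  by_cases h2 : ∀ i, ∃ w, x i = Sum.inr w
  · choose z hz using h2
    exact Or.inr (Or.inl ⟨z, funext hz⟩)
  push Not at h1 h2
  obtain ⟨j, hj⟩ := h1
  obtain ⟨i, hi⟩ := h2
  right; right
  rcases hxi : x i with u | w
  · rcases hxj : x j with u' | w'
    · exact absurd hxj (hj u')
    · exact ⟨i, j, u, w', hxi, hxj⟩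
  · exact absurd hxi (hi w)

/-- Rank is subadditive under direct sums. -/
lemma HasRankLE.dsum {k : ℕ} {ι κ : Fin (k + 1) → Type} {T : Tensor ι} {S : Tensor κ} {r s : ℕ}
    (hT : HasRankLE T r) (hS : HasRankLE S s) : HasRankLE (dsum T S) (r + s) := by
  obtain ⟨v, hv⟩ := hT
  obtain ⟨w, hw⟩ := hS
  have key := hasRankLE_of_sum (T := Subadditivity.dsum T S) (κ := Fin r ⊕ Fin s)
    (Sum.elim (fun j i => Sum.elim (v j i) 0) (fun j i => Sum.elim 0 (w j i))) ?_
  · simpa using key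
  intro x
  rw [Fintype.sum_sum_type]
  rcases eq_inl_or_eq_inr_or_mixed x with ⟨y, rfl⟩ | ⟨z, rfl⟩ | ⟨i, j, u, u', hi, hj⟩
  · rw [dsum_inl, hv]
    simp
  · rw [dsum_inr, hw]
    simp
  · rw [dsum_mixed T S hi hj]
    have h1 : ∀ l, ∏ i, Sum.elim (v l i) (0 : κ i → ℂ) (x i) = 0 := fun l =>
      Finset.prod_eq_zero (Finset.mem_univ j) (by simp [hj])
    have h2 : ∀ l, ∏ i, Sum.elim (0 : ι i → ℂ) (w l i) (x i) = 0 := fun l =>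
      Finset.prod_eq_zero (Finset.mem_univ i) (by simp [hi])
    simp [h1, h2]

/-- Flattening lower bound: a nonsingular minor of a flattening along the `i₀`-th factor has
size at most the border rank. -/
lemma card_le_of_hasBorderRankLE {k : ℕ} {ι : Fin k → Type} {T : Tensor ι} {r : ℕ}
    (h : HasBorderRankLE T r) {m : Type} [Fintype m] [DecidableEq m] (i₀ : Fin k)
    (c : m → ∀ i, ι i) (hdet : (Matrix.of fun p q => T (Function.update (c p) i₀ (c q i₀))).det ≠ 0) :
    Fintype.card m ≤ r := by
  have hcont : Continuous fun S : Tensor ι =>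
      (Matrix.of fun p q => S (Function.update (c p) i₀ (c q i₀))).det := by
    refine Continuous.matrix_det (continuous_matrix fun p q => ?_)
    exact continuous_apply _
  obtain ⟨S, hS, v, rfl⟩ := mem_closure_iff.1 h _ (isOpen_ne_fun hcont continuous_const) hdet
  have hfac : (Matrix.of fun p q => (fun x => ∑ j : Fin r, ∏ i : Fin k, v j i (x i))
      (Function.update (c p) i₀ (c q i₀))) =
      (Matrix.of fun (p : m) (j : Fin r) => ∏ i ∈ Finset.univ.erase i₀, v j i (c p i)) *
      (Matrix.of fun (j : Fin r) (q : m) => v j i₀ (c q i₀)) := by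
    ext p q
    simp only [Matrix.of_apply, Matrix.mul_apply]
    refine Finset.sum_congr rfl fun j _ => ?_
    rw [← Finset.prod_erase_mul _ _ (Finset.mem_univ i₀)]
    congr 1
    · refine Finset.prod_congr rfl fun i hi => ?_
      rw [Function.update_of_ne (Finset.ne_of_mem_erase hi)]
    · simp
  have hrank := Matrix.rank_of_isUnit _ ((Matrix.isUnit_iff_isUnit_det _).2
    (isUnit_iff_ne_zero.2 hS))
  rw [← hrank, hfac]
  refine (Matrix.rank_mul_le_right _ _).trans ((Matrix.rank_le_card_height _).trans ?_)
  simp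

lemma borderRank_eq {k : ℕ} {ι : Fin k → Type} {T : Tensor ι} {r : ℕ}
    (h : HasBorderRankLE T r) (h' : ∀ s, HasBorderRankLE T s → r ≤ s) : borderRank T = r :=
  le_antisymm (Nat.sInf_le h) (h' _ (Nat.sInf_mem (s := {r | HasBorderRankLE T r}) ⟨r, h⟩))

/-- Monomial degenerations of the multiplication tensor of `ℂ[s]/(s^T - 1)`: integer exponents
`e` select the entries whose total exponent vanishes modulo `T`, and the integer weights `ω`
make all of these but the ones with total weight zero vanish in the limit. -/
lemma hasBorderRankLE_of_weights {k : ℕ} {ι : Fin (k + 1) → Type} {T : ℕ} (hT : 0 < T)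
    (e ω : ∀ i, ι i → ℤ) {X : Tensor ι}
    (h : ∀ x, (X x = 1 ∧ (T : ℤ) ∣ ∑ i, e i (x i) ∧ ∑ i, ω i (x i) = 0) ∨
      (X x = 0 ∧ ((T : ℤ) ∣ ∑ i, e i (x i) → 0 < ∑ i, ω i (x i)))) :
    HasBorderRankLE X T := by
  have hT0 : T ≠ 0 := hT.ne'
  obtain ⟨ζ, hζ⟩ : ∃ ζ : ℂ, IsPrimitiveRoot ζ T := ⟨_, Complex.isPrimitiveRoot_exp T hT0⟩
  have hζ0 : ζ ≠ 0 := hζ.ne_zero hT0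
  have hsum : ∀ a : ℤ, ∑ r : Fin T, (T : ℂ)⁻¹ * (ζ ^ (r : ℕ)) ^ a =
      if (T : ℤ) ∣ a then 1 else 0 := by
    intro a
    have hcomm : ∀ r : ℕ, (ζ ^ r) ^ a = (ζ ^ a) ^ r := fun r => by
      rw [← zpow_natCast, ← zpow_natCast, ← zpow_mul, ← zpow_mul, mul_comm]
    rw [← Finset.mul_sum, Fin.sum_univ_eq_sum_range (fun r => (ζ ^ r) ^ a)]
    simp_rw [hcomm]
    split_ifs with hd
    · rw [(hζ.zpow_eq_one_iff_dvd a).2 hd]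
      simp [hT0]
    · have h1 : ζ ^ a ≠ 1 := fun h => hd ((hζ.zpow_eq_one_iff_dvd a).1 h)
      rw [geom_sum_eq h1, ← hcomm, hζ.pow_eq_one]
      simp
  let F : ℂ → Tensor ι := fun ε x => ε ^ (∑ i, ω i (x i)) *
    if (T : ℤ) ∣ ∑ i, e i (x i) then 1 else 0
  refine mem_closure_of_tendsto (f := F) (b := nhdsWithin 0 {0}ᶜ) ?_ ?_
  · rw [tendsto_pi_nhds]
    intro x
    rcases h x with ⟨h1, h2, h3⟩ | ⟨h1, h2⟩
    · simp [F, h1, h2, h3]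
    · by_cases hd : (T : ℤ) ∣ ∑ i, e i (x i)
      · obtain ⟨w, hw⟩ := Int.eq_ofNat_of_zero_le (h2 hd).le
        have hw0 : w ≠ 0 := by
          have := h2 hd
          omega
        simp only [F, h1, hd, hw, if_true, mul_one, zpow_natCast]
        have : Filter.Tendsto (fun ε : ℂ => ε ^ w) (nhds 0) (nhds 0) := by
          have := (continuous_pow (M := ℂ) w).tendsto 0
          rwa [zero_pow hw0] at this
        exact this.mono_left nhdsWithin_le_nhds
      · simp [F, h1, hd]
  · filter_upwards [self_mem_nhdsWithin] with ε hε
    have hε0 : ε ≠ 0 := hε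
    refine ⟨fun r i u => (if i = 0 then (T : ℂ)⁻¹ else 1) * (ε ^ ω i u * (ζ ^ (r : ℕ)) ^ e i u), ?_⟩
    have hpow : ∀ (b : ℂ) (hb : b ≠ 0) (f : Fin (k + 1) → ℤ), ∏ i, b ^ f i = b ^ ∑ i, f i := by
      intro b hb f
      induction (Finset.univ : Finset (Fin (k + 1))) using Finset.induction_on with
      | empty => simp
      | insert a s ha ih => rw [Finset.prod_insert ha, Finset.sum_insert ha, ih, zpow_add₀ hb]
    funext x
    simp only [F, ← hsum]
    rw [Finset.mul_sum]
    refine Finset.sum_congr rfl fun r _ => ?_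
    rw [Finset.prod_mul_distrib, Finset.prod_mul_distrib, hpow ε hε0,
      hpow _ (pow_ne_zero _ hζ0), Finset.prod_ite_eq' Finset.univ (0 : Fin (k + 1))]
    simp
    ring

@[simp] lemma vlow_cast {n d : ℕ} {i : Fin (d + 1)} (h : (i : ℕ) < d) (a : Fin n)
    (h' : Fin n = famV n d i) : vlow h (cast h' a) = a := by
  simp [vlow]

@[simp] lemma vhigh_cast {n d : ℕ} {i : Fin (d + 1)} (h : ¬ (i : ℕ) < d) (a : Fin d → Fin n)
    (h' : (Fin d → Fin n) = famV n d i) : vhigh h (cast h' a) = a := by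
  simp [vhigh]

@[simp] lemma wlow_cast {N d : ℕ} {i : Fin (d + 1)} (h : (i : ℕ) < 2) (a : Fin N)
    (h' : Fin N = famW N d i) : wlow h (cast h' a) = a := by
  simp [wlow]

lemma prod_delta {n d : ℕ} (f g : Fin d → Fin n) :
    ∏ j, delta (f j) (g j) = if f = g then 1 else 0 := by
  split_ifs with h
  · simp [h, delta]
  · obtain ⟨j, hj⟩ := Function.ne_iff.1 h
    exact Finset.prod_eq_zero (Finset.mem_univ j) (by simp [delta, hj])

lemma hasRankLE_bigSpider (n d : ℕ) : HasRankLE (bigSpider n d) (n ^ d) := by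
  have key := hasRankLE_of_sum (T := bigSpider n d) (κ := Fin d → Fin n)
    (fun J i u => if h : (i : ℕ) < d then delta (vlow h u) (J ⟨i, h⟩)
      else if vhigh h u = J then 1 else 0) ?_
  · simpa using key
  intro x
  simp [Fin.prod_univ_castSucc, bigSpider]

lemma hasRankLE_bigMat (N d : ℕ) (hd : 1 ≤ d) : HasRankLE (bigMat N d hd) N := by
  obtain ⟨d, rfl⟩ := Nat.exists_eq_add_of_le' hd
  have key := hasRankLE_of_sum (T := bigMat N (d + 1) hd) (κ := Fin N)
    (fun j i u => if h : (i : ℕ) < 2 then delta (wlow h u) j else 1) ?_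
  · simpa using key
  intro x
  simp [Fin.prod_univ_succ, bigMat, delta]
  exact if_congr eq_comm rfl rfl

lemma borderRank_bigSpider (n d : ℕ) : borderRank (bigSpider n d) = n ^ d := by
  refine borderRank_eq (hasRankLE_bigSpider n d).hasBorderRankLE fun s hs => ?_
  have key := card_le_of_hasBorderRankLE hs (m := Fin d → Fin n) (Fin.last d)
    (fun J i => if h : (i : ℕ) < d then cast (by simp [famV, h]) (J ⟨i, h⟩)
      else cast (by simp [famV, h]) J) ?_
  · simpa using key
  have h1 : (Matrix.of fun p q : Fin d → Fin n => bigSpider n d (Function.update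
      (fun i => if h : (i : ℕ) < d then cast (by simp [famV, h]) (p ⟨i, h⟩)
        else cast (by simp [famV, h]) p) (Fin.last d)
      (if h : (Fin.last d : ℕ) < d then cast (by simp at h) (q ⟨Fin.last d, h⟩)
        else cast (by simp [famV]) q))) = 1 := by
    ext p q
    simp [bigSpider, prod_delta, Matrix.one_apply]
  rw [h1]
  simp

lemma borderRank_bigMat (N d : ℕ) (hd : 1 ≤ d) : borderRank (bigMat N d hd) = N := by
  refine borderRank_eq (hasRankLE_bigMat N d hd).hasBorderRankLE fun s hs => ?_
  have key := card_le_of_hasBorderRankLE hs (m := Fin N) ⟨0, Nat.succ_pos d⟩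
    (fun J i => if h : (i : ℕ) < 2 then cast (by simp [famW, h]) J
      else cast (by simp [famW, h]) (0 : Fin 1)) ?_
  · simpa using key
  have h1 : (Matrix.of fun p q : Fin N => bigMat N d hd (Function.update
      (fun i => if h : (i : ℕ) < 2 then cast (by simp [famW, h]) p
        else cast (by simp [famW, h]) (0 : Fin 1)) ⟨0, Nat.succ_pos d⟩
      (cast (by simp [famW]) q))) = 1 := by
    ext p q
    simp [bigMat, delta, Matrix.one_apply, wlow]
    exact if_congr eq_comm rfl rfl
  simp only [Nat.ofNat_pos, dite_true]
  rw [h1]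
  simp

lemma mul_sum_pow_add (n m : ℕ) :
    n * (∑ j ∈ range m, n * n ^ j) + n = (∑ j ∈ range m, n * n ^ j) + n ^ (m + 1) := by
  induction m with
  | zero => simp
  | succ m ih =>
    rw [Finset.sum_range_succ, mul_add]
    have : n ^ (m + 1 + 1) = n * (n * n ^ m) := by ring
    have : n * n ^ m = n ^ (m + 1) := by ring
    omega

/-- There are at least `M` residues below `T = M + 2 n (L + 1)` that avoid the sums `a + n² q`
and the complements of the sums `n b + n² q`, for `a, b < n` and `q ≤ L`. -/
lemma exists_injective_avoiding (n L M N : ℕ) (hN : N ≤ M) :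
    ∃ p : Fin N → ℕ, Function.Injective p ∧ (∀ l, p l < M + 2 * (n * (L + 1))) ∧
      (∀ l a q, a < n → q ≤ L → p l ≠ a + n ^ 2 * q) ∧
      (∀ l b q, b < n → q ≤ L → p l + b * n + n ^ 2 * q + 1 ≠ M + 2 * (n * (L + 1))) := by
  set T := M + 2 * (n * (L + 1)) with hT
  let A : Finset ℕ := (range n ×ˢ range (L + 1)).image fun r => r.1 + n ^ 2 * r.2
  let B : Finset ℕ := (range n ×ˢ range (L + 1)).image fun r => T - 1 - (r.1 * n + n ^ 2 * r.2)
  have hA : A.card ≤ n * (L + 1) := Finset.card_image_le.trans (by simp)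
  have hB : B.card ≤ n * (L + 1) := Finset.card_image_le.trans (by simp)
  have hcard : N ≤ (range T \ (A ∪ B)).card := by
    have h1 := Finset.le_card_sdiff (A ∪ B) (range T)
    have h2 := Finset.card_union_le A B
    rw [Finset.card_range] at h1
    omega
  obtain ⟨P, hP, hPc⟩ := Finset.exists_subset_card_eq hcard
  have hmem : ∀ l, P.orderEmbOfFin hPc l ∈ range T \ (A ∪ B) := fun l =>
    hP (P.orderEmbOfFin_mem hPc l)
  refine ⟨fun l => P.orderEmbOfFin hPc l, (P.orderEmbOfFin hPc).injective, fun l => ?_,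
    fun l a q ha hq h => ?_, fun l b q hb hq h => ?_⟩
  · exact Finset.mem_range.1 (Finset.mem_sdiff.1 (hmem l)).1
  · refine (Finset.mem_sdiff.1 (hmem l)).2 (Finset.mem_union_left _ ?_)
    exact Finset.mem_image.2 ⟨(a, q), by simp [ha]; omega, h.symm⟩
  · refine (Finset.mem_sdiff.1 (hmem l)).2 (Finset.mem_union_right _ ?_)
    refine Finset.mem_image.2 ⟨(b, q), by simp [hb]; omega, ?_⟩
    have h' : P.orderEmbOfFin hPc l + b * n + n ^ 2 * q + 1 = T := h
    simp only
    omega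

/-- Digit of the monomial exponent attached to the `i`-th basis vector of the `j`-th factor;
it is shifted to be positive for `j ≥ 2`. -/
def digit (j i : ℕ) : ℕ := if j < 2 then i else i + 1

/-- Exponent of the monomial attached to a tuple of basis vectors. -/
def tupleExp (n d : ℕ) (J : Fin d → Fin n) : ℕ := ∑ j : Fin d, digit (j : ℕ) (J j : ℕ) * n ^ (j : ℕ)

lemma tupleExp_eq (n m : ℕ) (J : Fin (m + 2) → Fin n) :
    tupleExp n (m + 2) J =
      (finFunctionFinEquiv J : ℕ) + n * ∑ j ∈ range m, n * n ^ j := by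
  have h1 : ∀ j : Fin (m + 2), digit (j : ℕ) (J j : ℕ) * n ^ (j : ℕ) =
      (J j : ℕ) * n ^ (j : ℕ) + if (j : ℕ) < 2 then 0 else n ^ (j : ℕ) := by
    intro j
    unfold digit
    split_ifs <;> ring
  simp only [tupleExp, h1, Finset.sum_add_distrib, finFunctionFinEquiv_apply]
  congr 1
  rw [Fin.sum_univ_succ, Fin.sum_univ_succ, ← Fin.sum_univ_eq_sum_range (fun j => n * n ^ j)]
  simp [Finset.mul_sum, pow_succ]
  exact Finset.sum_congr rfl fun j _ => by ring

lemma tupleExp_injective (n m : ℕ) : Function.Injective (tupleExp n (m + 2)) := by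
  intro J J' h
  rw [tupleExp_eq, tupleExp_eq] at h
  exact finFunctionFinEquiv.injective (Fin.ext (by omega))

lemma tupleExp_lt (n m : ℕ) (J : Fin (m + 2) → Fin n) :
    tupleExp n (m + 2) J < n ^ (m + 2) + n * ∑ j ∈ range m, n * n ^ j := by
  rw [tupleExp_eq]
  have := (finFunctionFinEquiv J).2
  omega

/-- Exponents of the monomials in the degeneration of the multiplication tensor. -/
def expo (n m N T : ℕ) (p : Fin N → ℕ) :
    ∀ i : Fin (m + 2 + 1), famV n (m + 2) i ⊕ famW N (m + 2) i → ℤ := fun i => Sum.elim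
  (fun u => if h : (i : ℕ) < m + 2 then ((digit i (vlow h u) * n ^ (i : ℕ) : ℕ) : ℤ)
    else -(tupleExp n (m + 2) (vhigh h u) : ℤ))
  (fun u => if h : (i : ℕ) < 2 then
      if (i : ℕ) = 0 then (p (wlow h u) : ℤ) else (T : ℤ) - 1 - p (wlow h u)
    else if (i : ℕ) < m + 2 then 0 else 1 - (T : ℤ))

/-- Scaling weights of the basis vectors in the degeneration. -/
def weight (n m N T : ℕ) (p : Fin N → ℕ) :
    ∀ i : Fin (m + 2 + 1), famV n (m + 2) i ⊕ famW N (m + 2) i → ℤ := fun i => Sum.elim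
  (fun _ => 0)
  (fun u => if h : (i : ℕ) < 2 then
      if (i : ℕ) = 0 then ((m + 1) * T + 1 : ℤ) - (m + 1) * p (wlow h u)
      else ((m + 1) * T + 1 : ℤ) + (m + 1) * p (wlow h u)
    else if (i : ℕ) < m + 2 then 1 else -2 * ((m + 1) * T + 1 : ℤ) - m)

section

variable {n m N T : ℕ} {p : Fin N → ℕ}

lemma expo_weight_zero
    (u : famV n (m + 2) (0 : Fin (m + 1 + 1)).castSucc ⊕
      famW N (m + 2) (0 : Fin (m + 1 + 1)).castSucc) :
    ((∃ v, u = Sum.inl v) ∧ ∃ a : ℕ, a < n ∧ expo n m N T p _ u = a ∧ weight n m N T p _ u = 0) ∨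
    ((∃ v, u = Sum.inr v) ∧ ∃ l, expo n m N T p _ u = p l ∧
      weight n m N T p _ u = ((m + 1) * T + 1 : ℤ) - (m + 1) * p l) := by
  rcases u with v | v
  · refine Or.inl ⟨⟨v, rfl⟩, vlow (by simp) v, Fin.is_lt _, ?_, ?_⟩ <;>
      simp only [expo, weight, Sum.elim_inl] <;> simp [digit]
  · refine Or.inr ⟨⟨v, rfl⟩, wlow (by simp) v, ?_, ?_⟩ <;>
      (simp only [expo, weight, Sum.elim_inr]; simp)

lemma expo_weight_one
    (u : famV n (m + 2) (Fin.succ (0 : Fin (m + 1))).castSucc ⊕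
      famW N (m + 2) (Fin.succ (0 : Fin (m + 1))).castSucc) :
    ((∃ v, u = Sum.inl v) ∧ ∃ b : ℕ, b < n ∧ expo n m N T p _ u = b * n ∧
      weight n m N T p _ u = 0) ∨
    ((∃ v, u = Sum.inr v) ∧ ∃ l, expo n m N T p _ u = (T : ℤ) - 1 - p l ∧
      weight n m N T p _ u = ((m + 1) * T + 1 : ℤ) + (m + 1) * p l) := by
  rcases u with v | v
  · refine Or.inl ⟨⟨v, rfl⟩, vlow (by simp) v, Fin.is_lt _, ?_, ?_⟩ <;>
      simp only [expo, weight, Sum.elim_inl] <;> simp [digit]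
  · refine Or.inr ⟨⟨v, rfl⟩, wlow (by simp) v, ?_, ?_⟩ <;>
      (simp only [expo, weight, Sum.elim_inr]; simp)

lemma expo_weight_last
    (u : famV n (m + 2) (Fin.last (m + 2)) ⊕ famW N (m + 2) (Fin.last (m + 2))) :
    ((∃ v, u = Sum.inl v) ∧ ∃ J, expo n m N T p _ u = -(tupleExp n (m + 2) J : ℤ) ∧
      weight n m N T p _ u = 0) ∨
    ((∃ v, u = Sum.inr v) ∧ expo n m N T p _ u = 1 - (T : ℤ) ∧
      weight n m N T p _ u = -2 * ((m + 1) * T + 1 : ℤ) - m) := by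
  rcases u with v | v
  · refine Or.inl ⟨⟨v, rfl⟩, vhigh (by simp) v, ?_, ?_⟩ <;> simp [expo, weight]
  · refine Or.inr ⟨⟨v, rfl⟩, ?_, ?_⟩ <;> simp [expo, weight]

lemma expo_weight_mid (hn : 1 ≤ n) (j : Fin m)
    (u : famV n (m + 2) j.succ.succ.castSucc ⊕ famW N (m + 2) j.succ.succ.castSucc) :
    ((∃ v, u = Sum.inl v) ∧ ∃ q : ℕ, 1 ≤ q ∧ q ≤ n * n ^ (j : ℕ) ∧
      expo n m N T p _ u = n ^ 2 * q ∧ weight n m N T p _ u = 0) ∨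
    ((∃ v, u = Sum.inr v) ∧ expo n m N T p _ u = 0 ∧ weight n m N T p _ u = 1) := by
  rcases u with v | v
  · have hlt : ((j.succ.succ.castSucc : Fin (m + 2 + 1)) : ℕ) < m + 2 := by simp
    refine Or.inl ⟨⟨v, rfl⟩, ((vlow hlt v : ℕ) + 1) * n ^ (j : ℕ), ?_, ?_, ?_, ?_⟩
    · exact Nat.mul_pos (Nat.succ_pos _) (pow_pos hn _)
    · exact Nat.mul_le_mul_right _ (vlow hlt v).2
    · simp [expo, digit]
      ring
    · simp [weight]
  · refine Or.inr ⟨⟨v, rfl⟩, ?_, ?_⟩ <;> simp [expo, weight]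

lemma sum_split (f : Fin (m + 2 + 1) → ℤ) :
    ∑ i, f i = f (0 : Fin (m + 1 + 1)).castSucc + f (Fin.succ (0 : Fin (m + 1))).castSucc +
      ∑ j : Fin m, f j.succ.succ.castSucc + f (Fin.last (m + 2)) := by
  rw [Fin.sum_univ_castSucc, Fin.sum_univ_succ, Fin.sum_univ_succ]
  ring

lemma forall_split {P : Fin (m + 2 + 1) → Prop} (h0 : P (0 : Fin (m + 1 + 1)).castSucc)
    (h1 : P (Fin.succ (0 : Fin (m + 1))).castSucc)
    (h2 : ∀ j : Fin m, P j.succ.succ.castSucc) (h3 : P (Fin.last (m + 2))) (i) : P i :=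
  Fin.lastCases h3 (fun i => Fin.cases h0 (fun i => Fin.cases h1 h2 i) i) i

lemma expo_weight_mid_sum (hn : 1 ≤ n)
    (x : ∀ i, famV n (m + 2) i ⊕ famW N (m + 2) i) :
    ∃ q z : ℕ, q ≤ ∑ j ∈ range m, n * n ^ j ∧ z ≤ m ∧
      ∑ j : Fin m, expo n m N T p j.succ.succ.castSucc (x _) = n ^ 2 * q ∧
      ∑ j : Fin m, weight n m N T p j.succ.succ.castSucc (x _) = z ∧
      ((∀ j : Fin m, ∃ v, x j.succ.succ.castSucc = Sum.inl v) ∨ 1 ≤ z) ∧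
      ((∀ j : Fin m, ∃ v, x j.succ.succ.castSucc = Sum.inr v) ∨ 1 ≤ q) := by
  have key : ∀ j : Fin m, ∃ q z : ℕ, q ≤ n * n ^ (j : ℕ) ∧ z ≤ 1 ∧
      expo n m N T p j.succ.succ.castSucc (x _) = n ^ 2 * q ∧
      weight n m N T p j.succ.succ.castSucc (x _) = z ∧
      ((∃ v, x j.succ.succ.castSucc = Sum.inl v) ∨ 1 ≤ z) ∧
      ((∃ v, x j.succ.succ.castSucc = Sum.inr v) ∨ 1 ≤ q) := by
    intro j
    rcases expo_weight_mid (T := T) (p := p) hn j (x _) with ⟨h, q, h1, h2, h3, h4⟩ | ⟨h, h3, h4⟩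
    · exact ⟨q, 0, h2, by simp, h3, h4.trans (by simp), Or.inl h, Or.inr h1⟩
    · exact ⟨0, 1, by simp, le_rfl, h3.trans (by simp), h4.trans (by simp), Or.inr le_rfl, Or.inl h⟩
  choose q z h1 h2 h3 h4 h5 h6 using key
  refine ⟨∑ j, q j, ∑ j, z j, ?_, ?_, ?_, ?_, ?_, ?_⟩
  · rw [← Fin.sum_univ_eq_sum_range (fun j => n * n ^ j)]
    exact Finset.sum_le_sum fun j _ => h1 j
  · exact (Finset.sum_le_sum fun j _ => h2 j).trans (by simp)
  · exact (Finset.sum_congr rfl fun j _ => h3 j).trans (by simp [Finset.mul_sum])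
  · exact (Finset.sum_congr rfl fun j _ => h4 j).trans (by simp)
  · by_cases h : ∀ j, z j = 0
    · exact Or.inl fun j => (h5 j).resolve_right (by simp [h j])
    · push Not at h
      obtain ⟨j, hj⟩ := h
      exact Or.inr ((Nat.one_le_iff_ne_zero.2 hj).trans
        (Finset.single_le_sum (fun _ _ => Nat.zero_le _) (Finset.mem_univ j)))
  · by_cases h : ∀ j, q j = 0
    · exact Or.inl fun j => (h6 j).resolve_right (by simp [h j])
    · push Not at h
      obtain ⟨j, hj⟩ := h
      exact Or.inr ((Nat.one_le_iff_ne_zero.2 hj).trans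
        (Finset.single_le_sum (fun _ _ => Nat.zero_le _) (Finset.mem_univ j)))

/-- The total exponent of an entry is greater than `-T` and its total weight is bounded below. -/
lemma neg_lt_sum_expo (hn : 1 ≤ n) (hp : ∀ l, p l < T)
    (hT : ∀ J, tupleExp n (m + 2) J < T) (x : ∀ i, famV n (m + 2) i ⊕ famW N (m + 2) i) :
    -(T : ℤ) < ∑ i, expo n m N T p i (x i) ∧
      -2 * ((m + 1) * T + 1 : ℤ) - m ≤ ∑ i, weight n m N T p i (x i) := by
  rw [sum_split, sum_split]
  obtain ⟨q, z, -, -, hq, hz, -, -⟩ := expo_weight_mid_sum (T := T) (p := p) hn x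
  rw [hq, hz]
  have hq0 : (0 : ℤ) ≤ n ^ 2 * q := by positivity
  have hz0 : (0 : ℤ) ≤ z := by positivity
  have hK : ∀ l, 0 ≤ ((m + 1) * T + 1 : ℤ) - (m + 1) * p l := by
    intro l
    have := hp l
    have : (p l : ℤ) ≤ T := by exact_mod_cast this.le
    nlinarith
  have hK' : ∀ l, 0 ≤ ((m + 1) * T + 1 : ℤ) + (m + 1) * p l := fun l => by positivity
  have hS : (0 : ℤ) ≤ 2 * ((m + 1) * T + 1 : ℤ) + m := by positivity
  have hT0 : (0 : ℤ) ≤ T := by positivity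
  constructor
  · have h0 : 0 ≤ expo n m N T p _ (x (0 : Fin (m + 1 + 1)).castSucc) := by
      rcases expo_weight_zero (T := T) (p := p) (x _) with ⟨-, a, -, h, -⟩ | ⟨-, l, h, -⟩ <;> rw [h] <;>
        positivity
    have h1 : 0 ≤ expo n m N T p _ (x (Fin.succ (0 : Fin (m + 1))).castSucc) := by
      rcases expo_weight_one (T := T) (p := p) (x _) with ⟨-, b, -, h, -⟩ | ⟨-, l, h, -⟩ <;> rw [h]
      · positivity
      · have := hp l
        omega
    have h2 : -(T : ℤ) < expo n m N T p _ (x (Fin.last (m + 2))) := by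
      rcases expo_weight_last (T := T) (p := p) (x _) with ⟨-, J, h, -⟩ | ⟨-, h, -⟩ <;> rw [h]
      · have := hT J
        omega
      · omega
    linarith
  · have h0 : 0 ≤ weight n m N T p _ (x (0 : Fin (m + 1 + 1)).castSucc) := by
      rcases expo_weight_zero (T := T) (p := p) (x _) with ⟨-, a, -, -, h⟩ | ⟨-, l, -, h⟩ <;> rw [h]
      exact hK l
    have h1 : 0 ≤ weight n m N T p _ (x (Fin.succ (0 : Fin (m + 1))).castSucc) := by
      rcases expo_weight_one (T := T) (p := p) (x _) with ⟨-, b, -, -, h⟩ | ⟨-, l, -, h⟩ <;> rw [h]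
      exact hK' l
    have h2 : -2 * ((m + 1) * T + 1 : ℤ) - m ≤ weight n m N T p _ (x (Fin.last (m + 2))) := by
      rcases expo_weight_last (T := T) (p := p) (x _) with ⟨-, J, -, h⟩ | ⟨-, -, h⟩ <;> rw [h]
      linarith
    linarith

/-- A mixed entry with total exponent zero has positive weight. -/
lemma sum_weight_pos (hn : 1 ≤ n) (hp : ∀ l, p l < T)
    (hA : ∀ l a q, a < n → q ≤ ∑ j ∈ range m, n * n ^ j → p l ≠ a + n ^ 2 * q)
    (hB : ∀ l b q, b < n → q ≤ ∑ j ∈ range m, n * n ^ j → p l + b * n + n ^ 2 * q + 1 ≠ T)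
    (hT : n ^ 2 + n ^ 2 * (∑ j ∈ range m, n * n ^ j) < T)
    {x : ∀ i, famV n (m + 2) i ⊕ famW N (m + 2) i} {i j : Fin (m + 2 + 1)}
    {u : famV n (m + 2) i} {w : famW N (m + 2) j} (hi : x i = Sum.inl u) (hj : x j = Sum.inr w)
    (h : ∑ i, expo n m N T p i (x i) = 0) : 0 < ∑ i, weight n m N T p i (x i) := by
  rw [sum_split] at h ⊢
  have hl : ¬ ∀ i, ∃ v, x i = Sum.inl v := fun hh => by
    obtain ⟨v, hv⟩ := hh j
    simp [hj] at hv
  have hr : ¬ ∀ i, ∃ v, x i = Sum.inr v := fun hh => by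
    obtain ⟨v, hv⟩ := hh i
    simp [hi] at hv
  obtain ⟨q, z, hqL, hzm, hq, hz, hz', hq'⟩ := expo_weight_mid_sum (T := T) (p := p) hn x
  rw [hq] at h
  rw [hz]
  have hz0 : (0 : ℤ) ≤ z := by positivity
  have hK : ∀ l, 0 < ((m + 1) * T + 1 : ℤ) - (m + 1) * p l := by
    intro l
    have : (p l : ℤ) ≤ T := by exact_mod_cast (hp l).le
    nlinarith
  have hK' : ∀ l, 0 < ((m + 1) * T + 1 : ℤ) + (m + 1) * p l := fun l => by positivity
  rcases expo_weight_last (T := T) (p := p) (x (Fin.last (m + 2))) with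
    ⟨h3, J, -, hw3⟩ | ⟨h3, he3, hw3⟩
  · rw [hw3]
    rcases expo_weight_zero (T := T) (p := p) (x (0 : Fin (m + 1 + 1)).castSucc) with
      ⟨h0, a, -, -, hw0⟩ | ⟨-, l, -, hw0⟩ <;>
    rcases expo_weight_one (T := T) (p := p) (x (Fin.succ (0 : Fin (m + 1))).castSucc) with
      ⟨h1, b, -, -, hw1⟩ | ⟨-, l', -, hw1⟩ <;> rw [hw0, hw1]
    · have : 1 ≤ z := hz'.resolve_left fun h2 => hl (forall_split h0 h1 h2 h3)
      have h' : (1 : ℤ) ≤ z := by exact_mod_cast this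
      linarith
    · linarith [hK' l']
    · linarith [hK l]
    · linarith [hK l, hK' l']
  · rw [he3] at h
    rw [hw3]
    rcases expo_weight_zero (T := T) (p := p) (x (0 : Fin (m + 1 + 1)).castSucc) with
      ⟨-, a, ha, he0, hw0⟩ | ⟨h0, l, he0, hw0⟩ <;>
    rcases expo_weight_one (T := T) (p := p) (x (Fin.succ (0 : Fin (m + 1))).castSucc) with
      ⟨-, b, hb, he1, hw1⟩ | ⟨h1, l', he1, hw1⟩ <;> rw [he0, he1] at h
    · exfalso
      have h' : a + b * n + n ^ 2 * q + 1 = T := by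
        zify
        linarith
      have h1 : (b + 1) * n ≤ n * n := Nat.mul_le_mul_right _ hb
      have h2 : n ^ 2 * q ≤ n ^ 2 * ∑ j ∈ range m, n * n ^ j := Nat.mul_le_mul_left _ hqL
      nlinarith
    · refine absurd ?_ (hA l' a q ha hqL)
      zify
      linarith
    · refine absurd ?_ (hB l b q hb hqL)
      zify
      linarith
    · rw [hw0, hw1]
      have hq1 : 1 ≤ q := hq'.resolve_left fun h2 => hr (forall_split h0 h1 h2 h3)
      have hpos : (1 : ℤ) ≤ n ^ 2 * q := by
        have : 1 ≤ n ^ 2 * q := Nat.mul_pos (pow_pos hn _) hq1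
        exact_mod_cast this
      have hpp : (p l' : ℤ) - p l = n ^ 2 * q := by linarith
      have : (m + 1 : ℤ) * 1 ≤ (m + 1) * ((p l' : ℤ) - p l) := by
        rw [hpp]
        exact mul_le_mul_of_nonneg_left hpos (by positivity)
      linarith

end

/-- Border rank bound for `T₁ ⊕ T₂` by a monomial degeneration of the multiplication tensor
of a truncated polynomial algebra. -/
lemma hasBorderRankLE_dsum (n m N : ℕ) (hn : 1 ≤ n) (hN : N ≤ n ^ (m + 2)) :
    HasBorderRankLE (dsum (bigSpider n (m + 2)) (bigMat N (m + 2) (by omega)))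
      (n ^ (m + 2) + 2 * (n * (∑ j ∈ range m, n * n ^ j + 1))) := by
  obtain ⟨p, hpinj, hp, hA, hB⟩ :=
    exists_injective_avoiding n (∑ j ∈ range m, n * n ^ j) (n ^ (m + 2)) N hN
  have hgeom := mul_sum_pow_add n m
  set L := ∑ j ∈ range m, n * n ^ j with hL
  set T := n ^ (m + 2) + 2 * (n * (L + 1)) with hTdef
  have hTpos : 0 < T := by positivity
  have hTexp : ∀ J, tupleExp n (m + 2) J < T := by
    intro J
    have := tupleExp_lt n m J
    rw [← hL] at this
    nlinarith
  have hTL : n ^ 2 + n ^ 2 * L < T := by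
    have h1 : n ^ 2 * L + n ^ 2 = n * L + n ^ (m + 2) := by
      calc n ^ 2 * L + n ^ 2 = n * (n * L + n) := by ring
        _ = n * L + n ^ (m + 2) := by rw [hgeom]; ring
    nlinarith
  let Y : ℤ := 2 * ((m + 1) * T + 1 : ℤ) + m + 1
  have hY : 0 < Y := by positivity
  refine hasBorderRankLE_of_weights hTpos (expo n m N T p)
    (fun i u => weight n m N T p i u + Y * expo n m N T p i u) fun x => ?_
  obtain ⟨hlow, hwlow⟩ := neg_lt_sum_expo hn hp hTexp x
  rw [Finset.sum_add_distrib, ← Finset.mul_sum]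
  have hcases : (T : ℤ) ∣ ∑ i, expo n m N T p i (x i) → ∑ i, expo n m N T p i (x i) = 0 ∨
      0 < ∑ i, weight n m N T p i (x i) + Y * ∑ i, expo n m N T p i (x i) := by
    rintro ⟨c, hc⟩
    rw [hc] at hlow ⊢
    have hT' : (1 : ℤ) ≤ T := by exact_mod_cast hTpos
    have hc0 : 0 ≤ c := by
      by_contra hneg
      nlinarith
    rcases hc0.eq_or_lt with rfl | hc1
    · simp
    · right
      have : 1 ≤ (T : ℤ) * c := by nlinarith
      have : Y * 1 ≤ Y * (T * c) := mul_le_mul_of_nonneg_left this hY.le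
      simp only [Y] at this ⊢
      linarith
  rcases eq_inl_or_eq_inr_or_mixed x with ⟨y, rfl⟩ | ⟨y, rfl⟩ | ⟨i, j, u, w, hi, hj⟩
  · rw [dsum_inl, bigSpider, prod_delta]
    set J : Fin (m + 2) → Fin n := fun j => vlow (by simp) (y (Fin.castSucc j))
    set J' : Fin (m + 2) → Fin n := vhigh (by simp) (y (Fin.last (m + 2)))
    have he : ∑ i, expo n m N T p i (Sum.inl (y i)) =
        (tupleExp n (m + 2) J : ℤ) - tupleExp n (m + 2) J' := by
      rw [Fin.sum_univ_castSucc]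
      simp [expo, tupleExp, J, J', sub_eq_add_neg]
    have hw : ∑ i, weight n m N T p i (Sum.inl (y i)) = 0 := by simp [weight]
    by_cases hJ : J = J'
    · left
      rw [he, hw, hJ]
      simp
    · right
      refine ⟨by simp [hJ], fun hd => (hcases hd).resolve_left fun h0 => hJ ?_⟩
      rw [he] at h0
      exact tupleExp_injective n m (by omega)
  · rw [dsum_inr, bigMat, delta]
    set l : Fin N := wlow (by simp) (y ⟨0, Nat.succ_pos _⟩)
    set l' : Fin N := wlow (by simp) (y ⟨1, by omega⟩)
    have he : ∑ i, expo n m N T p i (Sum.inr (y i)) = (p l : ℤ) - p l' := by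
      rw [sum_split]
      simp [expo]
      change (p l : ℤ) + (T - 1 - p l') + (1 - T) = _
      ring
    have hw : ∑ i, weight n m N T p i (Sum.inr (y i)) = (m + 1) * ((p l' : ℤ) - p l) := by
      rw [sum_split]
      simp [weight]
      change ((m + 1) * T + 1 : ℤ) - (m + 1) * p l + (((m + 1) * T + 1) + (m + 1) * p l') +
        -(2 * ((m + 1) * T + 1)) = _
      ring
    by_cases hll : l = l'
    · left
      rw [he, hw, hll]
      simp
    · right
      refine ⟨by simp [hll], fun hd => (hcases hd).resolve_left fun h0 => hll ?_⟩
      rw [he] at h0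
      exact hpinj (by omega)
  · right
    refine ⟨dsum_mixed _ _ hi hj, fun hd => ?_⟩
    rcases hcases hd with h0 | h0
    · have := sum_weight_pos hn hp hA hB hTL hi hj h0
      rw [h0]
      simpa using this
    · exact h0

/-- Theorem: Construction 3. For `n ≥ 1`, `d ≥ 3`, `1 ≤ N ≤ n^d`:
`R̲(T₁) = n^d`, `R̲(T₂) = N`, and
`R̲(T₁ ⊕ T₂) ≤ n^d + 2n^{d−1} + n²(n+1)^{d−3} + 1`. -/
theorem construction3 (n d N : ℕ) (hn : 1 ≤ n) (hd : 3 ≤ d)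
    (hN1 : 1 ≤ N) (hN2 : N ≤ n ^ d) :
    borderRank (bigSpider n d) = n ^ d ∧
    borderRank (bigMat N d (by omega)) = N ∧
    borderRank (dsum (bigSpider n d) (bigMat N d (by omega))) ≤
      n ^ d + 2 * n ^ (d - 1) + n ^ 2 * (n + 1) ^ (d - 3) + 1 := by
  refine ⟨borderRank_bigSpider n d, borderRank_bigMat N d _, ?_⟩
  obtain ⟨m, rfl⟩ := Nat.exists_eq_add_of_le' hd
  rcases le_or_gt n 2 with h2 | h3
  · refine (Nat.sInf_le ((hasRankLE_bigSpider n (m + 3)).dsum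
      (hasRankLE_bigMat N (m + 3) (by omega))).hasBorderRankLE).trans ?_
    have : n ^ (m + 3) ≤ 2 * n ^ (m + 3 - 1) := by
      rw [pow_succ']
      exact Nat.mul_le_mul_right _ h2
    omega
  · refine (Nat.sInf_le (hasBorderRankLE_dsum n (m + 1) N hn hN2)).trans ?_
    have hgeom := mul_sum_pow_add n (m + 1)
    set L := ∑ j ∈ range (m + 1), n * n ^ j
    have hpow : n ^ 2 * n ^ m ≤ n ^ 2 * (n + 1) ^ m :=
      Nat.mul_le_mul_left _ (Nat.pow_le_pow_left (Nat.le_succ n) m)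
    have h1 : n ^ (m + 1 + 1) = n ^ 2 * n ^ m := by ring
    have h3' : 3 * L ≤ n * L := Nat.mul_le_mul_right _ h3
    have h4 : m + 3 - 1 = m + 1 + 1 := rfl
    rw [h4, Nat.add_sub_cancel, mul_add n L 1]
    have h5 : n ^ (m + 1 + 2) = n ^ (m + 3) := rfl
    omega

end
end Subadditivity
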